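/- arXiv:2405.18603 — 2 statements merged into one kernel-verified Lean document; each statement's English description precedes it below -/
import Mathlib

section
/- Let M = diag(λ₁,…,λₙ) with λ₁ ≤ … ≤ λₙ, and suppose λ_{j-1} < λ_j = … = λ_k < λ_{k+1}. Then for any symmetric n×n matrix A and any index i with j ≤ i ≤ k, the one-sided derivative lim_{t→0⁺} (λ_i(M + tA) − λ_i)/t exists and equals λ_{i−j+1}(A|_E), where E = span(e_j,…,e_k) is the λ_i-eigenspace of M and A|_E denotes the (k−j+1)×(k−j+1) submatrix (A_{rs})_{r,s=j}^{k}. -/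
open scoped Real
open Real

/-- The eigenvalues of a symmetric (Hermitian) real matrix, sorted in increasing order.
Junk value `0` if the matrix is not Hermitian. -/
noncomputable def sortedEig {m : ℕ} (B : Matrix (Fin m) (Fin m) ℝ) : Fin m → ℝ := by
  classical
  exact if h : B.IsHermitian then h.eigenvalues ∘ Tuple.sort h.eigenvalues else 0

abbrev EV (n : ℕ) := EuclideanSpace ℝ (Fin n)

noncomputable def opOf {n : ℕ} (B : Matrix (Fin n) (Fin n) ℝ) : EV n →L[ℝ] EV n :=
  Matrix.toEuclideanCLM (n := Fin n) (𝕜 := ℝ) B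

theorem opOf_apply {n : ℕ} (B : Matrix (Fin n) (Fin n) ℝ) (x : EV n) (l : Fin n) :
    opOf B x l = ∑ r, B l r * x r := by
  simp [opOf, Matrix.mulVec, dotProduct]

theorem ev_inner {n : ℕ} (x y : EV n) : inner ℝ x y = ∑ l, x l * y l := by
  simp [PiLp.inner_apply, mul_comm]

theorem exists_basis {n : ℕ} (B : Matrix (Fin n) (Fin n) ℝ) (hB : B.IsHermitian) :
    Monotone (sortedEig B) ∧ ∃ w : OrthonormalBasis (Fin n) ℝ (EV n),
      ∀ r, opOf B (w r) = sortedEig B r • w r := by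
  have hs : sortedEig B = hB.eigenvalues ∘ Tuple.sort hB.eigenvalues := by
    unfold sortedEig
    exact dif_pos hB
  refine ⟨hs ▸ Tuple.monotone_sort _, 
    hB.eigenvectorBasis.reindex (Tuple.sort hB.eigenvalues).symm, fun r => ?_⟩
  have := hB.mulVec_eigenvectorBasis (Tuple.sort hB.eigenvalues r)
  ext l
  have h2 := congrFun this l
  simp only [Matrix.mulVec, dotProduct] at h2
  rw [opOf_apply]
  simpa [hs] using h2

theorem span_facts {n : ℕ} (w : OrthonormalBasis (Fin n) ℝ (EV n)) (K : Finset (Fin n)) :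
    ∃ U : Submodule ℝ (EV n), Module.finrank ℝ U = K.card ∧
      ∀ x ∈ U, ∀ r ∉ K, inner ℝ (w r) x = 0 := by
  classical
  refine ⟨Submodule.span ℝ (Set.range (fun r : K => w r)), ?_, ?_⟩
  · rw [finrank_span_eq_card]
    · simp
    · exact w.orthonormal.linearIndependent.comp _ Subtype.val_injective
  · intro x hx r hr
    induction hx using Submodule.span_induction with
    | mem x h =>
      obtain ⟨s, rfl⟩ := h
      apply w.orthonormal.2
      rintro rfl
      exact hr s.2
    | zero => simp
    | add x y _ _ h1 h2 => rw [inner_add_right, h1, h2, add_zero]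
    | smul a x _ h => rw [inner_smul_right, h, mul_zero]

theorem quad_expand {n : ℕ} (B : Matrix (Fin n) (Fin n) ℝ)
    (w : OrthonormalBasis (Fin n) ℝ (EV n)) (s : Fin n → ℝ)
    (hw : ∀ r, opOf B (w r) = s r • w r) (x : EV n) :
    inner ℝ x (opOf B x) = ∑ r, s r * (inner ℝ (w r) x)^2 := by
  conv_lhs => rw [← w.sum_repr' x]
  rw [map_sum, sum_inner]
  refine Finset.sum_congr rfl fun r _ => ?_
  simp only [map_smul, hw, inner_smul_left, inner_sum, inner_smul_right]
  rw [Finset.sum_eq_single r]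
  · simp; ring
  · intro b _ hb
    rw [w.orthonormal.2 hb.symm]; simp
  · simp

theorem norm_expand {n : ℕ} (w : OrthonormalBasis (Fin n) ℝ (EV n)) (x : EV n) :
    inner ℝ x x = ∑ r, (inner ℝ (w r) x)^2 := by
  rw [real_inner_self_eq_norm_sq, ← w.sum_sq_norm_inner_right]
  simp

theorem eig_low {n : ℕ} (B : Matrix (Fin n) (Fin n) ℝ) (hB : B.IsHermitian) (i : Fin n) :
    ∃ U : Submodule ℝ (EV n), Module.finrank ℝ U = i + 1 ∧
      ∀ x ∈ U, inner ℝ x (opOf B x) ≤ sortedEig B i * inner ℝ x x := by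
  obtain ⟨hm, w, hw⟩ := exists_basis B hB
  obtain ⟨U, hU, h⟩ := span_facts w (Finset.Iic i)
  refine ⟨U, by simpa using hU, fun x hx => ?_⟩
  rw [quad_expand B w _ hw, norm_expand w, Finset.mul_sum]
  refine Finset.sum_le_sum fun r _ => ?_
  by_cases hr : r ∈ Finset.Iic i
  · exact mul_le_mul_of_nonneg_right (hm (by simpa using hr)) (sq_nonneg _)
  · simp [h x hx r hr]

theorem eig_high {n : ℕ} (B : Matrix (Fin n) (Fin n) ℝ) (hB : B.IsHermitian) (i : Fin n) :
    ∃ U : Submodule ℝ (EV n), Module.finrank ℝ U = n - i ∧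
      ∀ x ∈ U, sortedEig B i * inner ℝ x x ≤ inner ℝ x (opOf B x) := by
  obtain ⟨hm, w, hw⟩ := exists_basis B hB
  obtain ⟨U, hU, h⟩ := span_facts w (Finset.Ici i)
  refine ⟨U, by simpa using hU, fun x hx => ?_⟩
  rw [quad_expand B w _ hw, norm_expand w, Finset.mul_sum]
  refine Finset.sum_le_sum fun r _ => ?_
  by_cases hr : r ∈ Finset.Ici i
  · exact mul_le_mul_of_nonneg_right (hm (by simpa using hr)) (sq_nonneg _)
  · simp [h x hx r hr]

theorem exists_common {n : ℕ} (U V : Submodule ℝ (EV n))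
    (h : n < Module.finrank ℝ U + Module.finrank ℝ V) : ∃ x ∈ U, x ∈ V ∧ 0 < inner ℝ x x := by
  have h1 := Submodule.finrank_sup_add_finrank_inf_eq U V
  have h2 : Module.finrank ℝ (U ⊔ V : Submodule ℝ (EV n)) ≤ n := by
    simpa using Submodule.finrank_le (U ⊔ V)
  have h3 : U ⊓ V ≠ ⊥ := by
    intro h0
    rw [h0, finrank_bot] at h1
    omega
  obtain ⟨x, hx, hx0⟩ := Submodule.exists_mem_ne_zero_of_ne_bot h3
  exact ⟨x, hx.1, hx.2, real_inner_self_pos.2 hx0⟩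

theorem eig_le {n : ℕ} (B : Matrix (Fin n) (Fin n) ℝ) (hB : B.IsHermitian) (i : Fin n) (c : ℝ)
    (U : Submodule ℝ (EV n)) (hU : Module.finrank ℝ U = i + 1)
    (h : ∀ x ∈ U, inner ℝ x (opOf B x) ≤ c * inner ℝ x x) : sortedEig B i ≤ c := by
  obtain ⟨V, hV, hV'⟩ := eig_high B hB i
  obtain ⟨x, hx, hx', hpos⟩ := exists_common U V (by omega)
  exact le_of_mul_le_mul_right ((hV' x hx').trans (h x hx)) hpos

theorem le_eig {n : ℕ} (B : Matrix (Fin n) (Fin n) ℝ) (hB : B.IsHermitian) (i : Fin n) (c : ℝ)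
    (U : Submodule ℝ (EV n)) (hU : Module.finrank ℝ U = n - i)
    (h : ∀ x ∈ U, c * inner ℝ x x ≤ inner ℝ x (opOf B x)) : c ≤ sortedEig B i := by
  obtain ⟨V, hV, hV'⟩ := eig_low B hB i
  obtain ⟨x, hx, hx', hpos⟩ := exists_common U V (by omega)
  exact le_of_mul_le_mul_right ((h x hx).trans (hV' x hx')) hpos

/-- Extension by zero along an injection. -/
noncomputable def emb {m n : ℕ} (f : Fin m → Fin n) : EV m →ₗ[ℝ] EV n where
  toFun v := WithLp.toLp 2 (fun l => ∑ r, if f r = l then v r else 0)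
  map_add' v w := by
    ext l
    simp [← Finset.sum_add_distrib, ← ite_add_zero]
  map_smul' a v := by
    ext l
    simp [Finset.mul_sum]

theorem emb_off {m n : ℕ} (f : Fin m → Fin n) (v : EV m) (l : Fin n)
    (h : l ∉ Set.range f) : emb f v l = 0 := by
  simp only [emb, LinearMap.coe_mk, AddHom.coe_mk]
  refine Finset.sum_eq_zero fun r _ => if_neg fun hr => h ⟨r, hr⟩

theorem emb_on {m n : ℕ} (f : Fin m → Fin n) (hf : f.Injective) (v : EV m) (r : Fin m) :
    emb f v (f r) = v r := by
  simp [emb, hf.eq_iff]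

theorem emb_sum {m n : ℕ} (f : Fin m → Fin n) (hf : f.Injective) (v : EV m) (h : Fin n → ℝ) :
    ∑ l, emb f v l * h l = ∑ r, v r * h (f r) := by
  refine (Fintype.sum_of_injective f hf _ _ ?_ ?_).symm
  · intro l hl
    rw [emb_off f v l hl, zero_mul]
  · intro r
    rw [emb_on f hf]

theorem emb_inner {m n : ℕ} (f : Fin m → Fin n) (hf : f.Injective) (v w : EV m) :
    inner ℝ (emb f v) (emb f w) = inner ℝ v w := by
  rw [ev_inner, emb_sum f hf, ev_inner]
  simp [emb_on f hf]

theorem emb_injective {m n : ℕ} (f : Fin m → Fin n) (hf : f.Injective) :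
    Function.Injective (emb f) := by
  intro v w h
  ext r
  rw [← emb_on f hf v, h, emb_on f hf]

theorem emb_quad {m n : ℕ} (f : Fin m → Fin n) (hf : f.Injective) (v : EV m)
    (A : Matrix (Fin n) (Fin n) ℝ) :
    inner ℝ (emb f v) (opOf A (emb f v)) = inner ℝ v (opOf (A.submatrix f f) v) := by
  rw [ev_inner, emb_sum f hf, ev_inner]
  refine Finset.sum_congr rfl fun r _ => ?_
  rw [opOf_apply, opOf_apply]
  congr 1
  simp_rw [mul_comm (A _ _), emb_sum f hf, mul_comm _ (A _ _)]
  simp [mul_comm]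

theorem emb_orth {m m' n : ℕ} (f : Fin m → Fin n) (g : Fin m' → Fin n)
    (hf : f.Injective) (hfg : ∀ r s, f r ≠ g s) (v : EV m) (w : EV m') :
    inner ℝ (emb f v) (emb g w) = 0 := by
  rw [ev_inner, emb_sum f hf]
  refine Finset.sum_eq_zero fun r _ => ?_
  rw [emb_off g, mul_zero]
  rintro ⟨s, hs⟩
  exact hfg r s hs.symm

theorem diag_apply {n : ℕ} (lam : Fin n → ℝ) (x : EV n) (l : Fin n) :
    opOf (Matrix.diagonal lam) x l = lam l * x l := by
  rw [opOf_apply]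
  simp [Matrix.diagonal_apply]

theorem diag_emb {m n : ℕ} (f : Fin m → Fin n) (lam : Fin n → ℝ) (μ : ℝ)
    (h : ∀ r, lam (f r) = μ) (v : EV m) :
    opOf (Matrix.diagonal lam) (emb f v) = μ • emb f v := by
  ext l
  rw [diag_apply]
  by_cases hl : l ∈ Set.range f
  · obtain ⟨r, rfl⟩ := hl
    simp [h]
  · simp [emb_off f v l hl]

theorem diag_emb_le {m n : ℕ} (f : Fin m → Fin n) (hf : f.Injective) (lam : Fin n → ℝ) (c : ℝ)
    (h : ∀ r, lam (f r) ≤ c) (v : EV m) :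
    inner ℝ (emb f v) (opOf (Matrix.diagonal lam) (emb f v)) ≤
      c * inner ℝ (emb f v) (emb f v) := by
  rw [emb_inner f hf, ev_inner, emb_sum f hf, ev_inner, Finset.mul_sum]
  refine Finset.sum_le_sum fun r _ => ?_
  rw [diag_apply, emb_on f hf]
  nlinarith [h r, mul_self_nonneg (v r)]

theorem exists_sum_space {m m' n : ℕ} (f : Fin m → Fin n) (g : Fin m' → Fin n)
    (hf : f.Injective) (hg : g.Injective) (hfg : ∀ r s, f r ≠ g s) (W : Submodule ℝ (EV m)) :
    ∃ U : Submodule ℝ (EV n), Module.finrank ℝ U = Module.finrank ℝ W + m' ∧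
      ∀ x ∈ U, ∃ w ∈ W, ∃ u, x = emb g u + emb f w := by
  refine ⟨W.map (emb f) ⊔ LinearMap.range (emb g), ?_, ?_⟩
  · have h1 := Submodule.finrank_sup_add_finrank_inf_eq (W.map (emb f)) (LinearMap.range (emb g))
    have h2 : W.map (emb f) ⊓ LinearMap.range (emb g) = ⊥ := by
      rw [eq_bot_iff]
      rintro x ⟨⟨w, _, rfl⟩, ⟨u, hu⟩⟩
      have := emb_orth f g hf hfg w u
      rw [hu] at this
      simpa using this
    rw [h2, finrank_bot, LinearMap.finrank_range_of_inj (emb_injective g hg),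
      ← (Submodule.equivMapOfInjective (emb f) (emb_injective f hf) W).finrank_eq] at h1
    simpa using h1
  · intro x hx
    obtain ⟨y, ⟨w, hw, rfl⟩, z, ⟨u, rfl⟩, rfl⟩ := Submodule.mem_sup.1 hx
    exact ⟨w, hw, u, add_comm _ _⟩

theorem perturb_est {E : Type*} [NormedAddCommGroup E] [InnerProductSpace ℝ E]
    (M A : E →L[ℝ] E) (μ ν g ε : ℝ) (hg : 0 < g) (hε : 0 < ε) :
    ∀ᶠ t : ℝ in nhdsWithin 0 (Set.Ioi 0), ∀ y z : E,
      inner ℝ y z = 0 → M z = μ • z → inner ℝ z (M y) = 0 →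
      inner ℝ y (M y) ≤ (μ - g) * inner ℝ y y →
      inner ℝ z (A z) ≤ ν * inner ℝ z z →
      inner ℝ (y + z) (M (y + z) + t • A (y + z)) ≤
        (μ + t * (ν + ε)) * inner ℝ (y + z) (y + z) := by
  set C := ‖A‖ with hC
  have hlim : Filter.Tendsto (fun t : ℝ => t * (C + C^2/ε - ν - ε)) (nhdsWithin 0 (Set.Ioi 0))
      (nhds 0) := by
    have : Continuous (fun t : ℝ => t * (C + C^2/ε - ν - ε)) := by fun_prop
    have h := this.tendsto 0
    rw [zero_mul] at h
    exact h.mono_left nhdsWithin_le_nhds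
  filter_upwards [hlim.eventually (gt_mem_nhds hg), self_mem_nhdsWithin] with t ht ht0
  intro y z hyz hMz hzMy hy hz
  have ht0 : 0 < t := ht0
  have hzy : inner ℝ z y = 0 := by rw [real_inner_comm]; exact hyz
  have bd : ∀ a b : E, inner ℝ a (A b) ≤ C * ‖a‖ * ‖b‖ := fun a b =>
    calc inner ℝ a (A b) ≤ ‖a‖ * ‖A b‖ := real_inner_le_norm _ _
      _ ≤ ‖a‖ * (C * ‖b‖) := by gcongr; exact A.le_opNorm b
      _ = _ := by ring
  have b1 := bd y y
  have b2 := bd y z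
  have b3 := bd z y
  simp only [map_add, inner_add_left, inner_add_right, inner_smul_right, hMz, hyz, hzy, hzMy,
    real_inner_self_eq_norm_sq] at *
  have key : 2 * (C * ‖y‖ * ‖z‖) ≤ ε * ‖z‖^2 + C^2/ε * ‖y‖^2 := by
    have h0 : 0 ≤ (ε * ‖z‖ - C * ‖y‖)^2 / ε := by positivity
    have : (ε * ‖z‖ - C * ‖y‖)^2 / ε = ε * ‖z‖^2 + C^2/ε * ‖y‖^2 - 2 * (C * ‖y‖ * ‖z‖) := by
      field_simp
      ring
    linarith
  have hsum : inner ℝ y (A y) + inner ℝ z (A y) + (inner ℝ y (A z) + inner ℝ z (A z)) ≤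
      (C + C^2/ε) * ‖y‖^2 + (ν + ε) * ‖z‖^2 := by nlinarith
  have h1 := mul_le_mul_of_nonneg_left hsum ht0.le
  have h2 := mul_le_mul_of_nonneg_right ht.le (sq_nonneg ‖y‖)
  nlinarith

theorem exists_gap {m : ℕ} (a : Fin m → ℝ) (μ : ℝ) (h : ∀ r, a r < μ) :
    ∃ g > 0, ∀ r, a r ≤ μ - g := by
  have : ∀ᶠ g : ℝ in nhdsWithin 0 (Set.Ioi 0), ∀ r, g < μ - a r := by
    rw [Filter.eventually_all]
    intro r
    exact nhdsWithin_le_nhds (gt_mem_nhds (sub_pos.2 (h r)))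
  obtain ⟨g, hg, hg0⟩ := (this.and self_mem_nhdsWithin).exists
  exact ⟨g, hg0, fun r => by linarith [hg r]⟩

theorem quad_bound {m m' n : ℕ} (f : Fin m → Fin n) (g : Fin m' → Fin n)
    (hf : f.Injective) (hg : g.Injective) (hfg : ∀ r s, f r ≠ g s)
    (lam : Fin n → ℝ) (μ ν ε : ℝ) (hε : 0 < ε) (hlf : ∀ r, lam (f r) = μ)
    (hlg : ∀ r, lam (g r) < μ) (A : Matrix (Fin n) (Fin n) ℝ) :
    ∀ᶠ t : ℝ in nhdsWithin 0 (Set.Ioi 0), ∀ u w,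
      inner ℝ w (opOf (A.submatrix f f) w) ≤ ν * inner ℝ w w →
      inner ℝ (emb g u + emb f w) (opOf (Matrix.diagonal lam + t • A) (emb g u + emb f w)) ≤
        (μ + t * (ν + ε)) * inner ℝ (emb g u + emb f w) (emb g u + emb f w) := by
  obtain ⟨γ, hγ, hγ'⟩ := exists_gap (fun r => lam (g r)) μ hlg
  filter_upwards [perturb_est (opOf (Matrix.diagonal lam)) (opOf A) μ ν γ ε hγ hε] with t ht
  intro u w hw
  have := ht (emb g u) (emb f w) (emb_orth g f hg (fun r s => (hfg s r).symm) u w)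
    (diag_emb f lam μ hlf w) ?_ (diag_emb_le g hg lam _ hγ' u) ?_
  · simpa [opOf] using this
  · rw [ev_inner, emb_sum f hf]
    refine Finset.sum_eq_zero fun r _ => ?_
    rw [diag_apply, emb_off g]
    · simp
    · rintro ⟨s, hs⟩
      exact hfg r s hs.symm
  · rw [emb_quad f hf, emb_inner f hf]
    exact hw

theorem opOf_neg {n : ℕ} (B : Matrix (Fin n) (Fin n) ℝ) (x : EV n) :
    opOf (-B) x = - opOf B x := by
  simp [opOf]

/-- One-sided derivative of sorted eigenvalues: if `M = diagonal lam` with `lam` increasing,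
`lam_{j-1} < lam_j = ⋯ = lam_k < lam_{k+1}`, and `j ≤ i ≤ k`, then for any symmetric `A`,
`lim_{t→0⁺} (λ_i(M + tA) − λ_i)/t = λ_{i−j+1}(A|_E)` where `A|_E = (A_{rs})_{r,s=j}^k`. -/
theorem onesided_eigenvalue_derivative {n : ℕ} (lam : Fin n → ℝ) (hmono : Monotone lam)
    (j k i : ℕ) (hjk : j ≤ k) (hk : k < n) (hji : j ≤ i) (hik : i ≤ k)
    (hlow : ∀ l : Fin n, (l : ℕ) < j → lam l < lam ⟨j, by omega⟩)
    (hhigh : ∀ l : Fin n, k < (l : ℕ) → lam ⟨k, by omega⟩ < lam l)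
    (heq : ∀ l : Fin n, j ≤ (l : ℕ) → (l : ℕ) ≤ k → lam l = lam ⟨j, by omega⟩)
    (A : Matrix (Fin n) (Fin n) ℝ) (hA : A.IsSymm) :
    Filter.Tendsto
      (fun t : ℝ =>
        (sortedEig (Matrix.diagonal lam + t • A) ⟨i, by omega⟩ - lam ⟨i, by omega⟩) / t)
      (nhdsWithin 0 (Set.Ioi 0))
      (nhds (sortedEig
        (A.submatrix (fun r : Fin (k + 1 - j) => (⟨j + r, by have := r.isLt; omega⟩ : Fin n))
          (fun r : Fin (k + 1 - j) => (⟨j + r, by have := r.isLt; omega⟩ : Fin n)))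
        ⟨i - j, by omega⟩)) := by
  set f : Fin (k + 1 - j) → Fin n := fun r => ⟨j + r, by have := r.isLt; omega⟩ with hf_def
  set S := A.submatrix f f with hS
  set ν := sortedEig S ⟨i - j, by omega⟩ with hν
  have hAh : A.IsHermitian := by
    rw [Matrix.IsHermitian, Matrix.conjTranspose_eq_transpose_of_trivial]; exact hA
  have hSh : S.IsHermitian := hAh.submatrix f
  have hBh : ∀ t : ℝ, (Matrix.diagonal lam + t • A).IsHermitian := by
    intro t
    refine Matrix.IsHermitian.add (Matrix.isHermitian_diagonal lam) ?_
    rw [Matrix.IsHermitian, Matrix.conjTranspose_smul, hAh.eq]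
    simp
  have hf : f.Injective := by
    intro r s h
    have := congrArg Fin.val h
    simp only [hf_def] at this
    ext; omega
  have hlf : ∀ r, lam (f r) = lam ⟨j, by omega⟩ := fun r =>
    heq (f r) (by simp [hf_def]) (by have := r.isLt; simp only [hf_def]; omega)
  have hli : lam ⟨i, by omega⟩ = lam ⟨j, by omega⟩ := heq _ hji hik
  have hlk : lam ⟨k, by omega⟩ = lam ⟨j, by omega⟩ := heq _ hjk le_rfl
  rw [hli]
  rw [hlk] at hhigh
  rw [tendsto_order]
  constructor
  · intro a ha
    let g : Fin (n - 1 - k) → Fin n := fun r => ⟨k + 1 + r, by have := r.isLt; omega⟩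
    have hg : g.Injective := by
      intro r s h
      have := congrArg Fin.val h
      simp only [g] at this
      ext; omega
    have hfg : ∀ r s, f r ≠ g s := by
      intro r s h
      have := congrArg Fin.val h
      have := r.isLt
      simp only [g, hf_def] at *
      omega
    obtain ⟨W, hW, hW'⟩ := eig_high S hSh ⟨i - j, by omega⟩
    obtain ⟨U, hU, hU'⟩ := exists_sum_space f g hf hg hfg W
    filter_upwards [quad_bound f g hf hg hfg (-lam) (-lam ⟨j, by omega⟩) (-ν) ((ν - a) / 2)
      (by linarith) (fun r => by simp [hlf])
      (fun r => by
        simp only [Pi.neg_apply, neg_lt_neg_iff]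
        exact hhigh _ (by simp only [g]; omega)) (-A), self_mem_nhdsWithin] with t ht ht0
    have ht0 : 0 < t := ht0
    have := le_eig _ (hBh t) ⟨i, by omega⟩ (lam ⟨j, by omega⟩ + t * (ν - (ν - a) / 2)) U
      (by rw [hU, hW]; simp only; omega) ?_
    · rw [lt_div_iff₀ ht0]
      nlinarith
    · intro x hx
      obtain ⟨w, hw, u, rfl⟩ := hU' x hx
      have h1 := ht u w ?_
      · have e : Matrix.diagonal (-lam) + t • (-A) = -(Matrix.diagonal lam + t • A) := by
          rw [neg_add, smul_neg, Matrix.diagonal_neg]; rfl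
        rw [e, opOf_neg, inner_neg_right] at h1
        linarith
      · have h2 := hW' w hw
        have e : (-A).submatrix f f = -S := rfl
        rw [e, opOf_neg, inner_neg_right]
        linarith
  · intro b hb
    let g : Fin j → Fin n := fun r => ⟨r, by have := r.isLt; omega⟩
    have hg : g.Injective := by
      intro r s h
      have := congrArg Fin.val h
      simp only [g] at this
      ext; omega
    have hfg : ∀ r s, f r ≠ g s := by
      intro r s h
      have := congrArg Fin.val h
      have := s.isLt
      simp only [g, hf_def] at *
      omega
    obtain ⟨W, hW, hW'⟩ := eig_low S hSh ⟨i - j, by omega⟩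
    obtain ⟨U, hU, hU'⟩ := exists_sum_space f g hf hg hfg W
    filter_upwards [quad_bound f g hf hg hfg lam (lam ⟨j, by omega⟩) ν ((b - ν) / 2)
      (by linarith) hlf (fun r => hlow _ r.isLt) A, self_mem_nhdsWithin] with t ht ht0
    have ht0 : 0 < t := ht0
    have := eig_le _ (hBh t) ⟨i, by omega⟩ (lam ⟨j, by omega⟩ + t * (ν + (b - ν) / 2)) U
      (by rw [hU, hW]; simp only; omega) ?_
    · rw [div_lt_iff₀ ht0]
      nlinarith
    · intro x hx
      obtain ⟨w, hw, u, rfl⟩ := hU' x hx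
      exact ht u w (hW' w hw)
end

section
/- Let M = diag(λ₁,…,λₙ) be as in the one-sided derivative lemma with λ_{j-1} < λ_j = … = λ_k < λ_{k+1}, E the common eigenspace, and A a symmetric matrix. Then for j ≤ i ≤ k, the two-sided derivative d/dt|_{t=0} λ_i(M + tA) exists if and only if λ_{i−j+1}(A|_E) = λ_{k−i+1}(A|_E). In particular, λ_j is differentiable at M in direction A if and only if A|_E is a scalar matrix. -/
open scoped Real
open Real

open Matrix in
theorem se_mono {m : ℕ} (B : Matrix (Fin m) (Fin m) ℝ) : Monotone (sortedEig B) := by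
  unfold sortedEig
  split_ifs with h
  · exact Tuple.monotone_sort _
  · exact monotone_const

open Matrix in
theorem se_spec {m : ℕ} (B : Matrix (Fin m) (Fin m) ℝ) (h : B.IsHermitian) :
    ∃ v : Fin m → Fin m → ℝ, ∀ x : Fin m → ℝ,
      x ⬝ᵥ x = ∑ s, (v s ⬝ᵥ x) ^ 2 ∧
      x ⬝ᵥ (B *ᵥ x) = ∑ s, sortedEig B s * (v s ⬝ᵥ x) ^ 2 := by
  set σ := Tuple.sort h.eigenvalues with hσ
  have hs : ∀ s, sortedEig B s = h.eigenvalues (σ s) := by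
    intro s; rw [sortedEig, dif_pos h]; rfl
  refine ⟨fun s => (h.eigenvectorBasis (σ s)).ofLp, fun x => ?_⟩
  have key : ∀ y : Fin m → ℝ, x ⬝ᵥ y = ∑ s, ((h.eigenvectorBasis (σ s)).ofLp ⬝ᵥ x) *
      ((h.eigenvectorBasis (σ s)).ofLp ⬝ᵥ y) := by
    intro y
    have := h.eigenvectorBasis.sum_inner_mul_inner (WithLp.toLp 2 x) (WithLp.toLp 2 y)
    rw [← Equiv.sum_comp σ] at this
    simp only [EuclideanSpace.inner_eq_star_dotProduct, star_trivial] at this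
    rw [dotProduct_comm x y, ← this]
    refine Finset.sum_congr rfl fun s _ => ?_
    rw [dotProduct_comm y]
  refine ⟨?_, ?_⟩
  · rw [key]; refine Finset.sum_congr rfl fun s _ => by ring
  · rw [key]; refine Finset.sum_congr rfl fun s _ => ?_
    have : (h.eigenvectorBasis (σ s)).ofLp ⬝ᵥ (B *ᵥ x)
        = h.eigenvalues (σ s) * ((h.eigenvectorBasis (σ s)).ofLp ⬝ᵥ x) := by
      rw [dotProduct_mulVec, ← mulVec_transpose]
      have hB : Bᵀ = B := (by simpa using h : B.IsSymm)
      rw [hB, h.mulVec_eigenvectorBasis, smul_dotProduct, smul_eq_mul]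
    rw [this, hs]; ring

open Matrix in
theorem exists_ker {m : ℕ} {κ : Type} [Fintype κ] (w : κ → Fin m → ℝ)
    (hc : Fintype.card κ < m) : ∃ x : Fin m → ℝ, x ≠ 0 ∧ ∀ a, w a ⬝ᵥ x = 0 := by
  have := LinearMap.ker_ne_bot_of_finrank_lt (f := (Matrix.mulVecLin (Matrix.of w)))
    (by simpa using hc)
  obtain ⟨x, hx, hx0⟩ := (Submodule.ne_bot_iff _).1 this
  exact ⟨x, hx0, fun a => congrFun (LinearMap.mem_ker.1 hx) a⟩

open Matrix in
theorem dot_pos {m : ℕ} {x : Fin m → ℝ} (hx : x ≠ 0) : 0 < x ⬝ᵥ x := by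
  have h1 : 0 ≤ x ⬝ᵥ x := Finset.sum_nonneg fun i _ => mul_self_nonneg _
  exact lt_of_le_of_ne h1 fun h => hx (dotProduct_self_eq_zero.1 h.symm)

theorem low_bound {m : ℕ} (f : Fin m → ℝ) (hf : Monotone f) (p : Fin m) (a : Fin m → ℝ)
    (ha : ∀ s, s < p → a s = 0) : f p * ∑ s, a s ^ 2 ≤ ∑ s, f s * a s ^ 2 := by
  rw [Finset.mul_sum]
  refine Finset.sum_le_sum fun s _ => ?_
  rcases lt_or_ge s p with h | h
  · simp [ha s h]
  · exact mul_le_mul_of_nonneg_right (hf h) (sq_nonneg _)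

theorem up_bound {m : ℕ} (f : Fin m → ℝ) (hf : Monotone f) (p : Fin m) (a : Fin m → ℝ)
    (ha : ∀ s, p < s → a s = 0) : ∑ s, f s * a s ^ 2 ≤ f p * ∑ s, a s ^ 2 := by
  rw [Finset.mul_sum]
  refine Finset.sum_le_sum fun s _ => ?_
  rcases lt_or_ge p s with h | h
  · simp [ha s h]
  · exact mul_le_mul_of_nonneg_right (hf h) (sq_nonneg _)

open Matrix in
theorem se_neg {m : ℕ} (B : Matrix (Fin m) (Fin m) ℝ) (h : B.IsHermitian) (p q : Fin m)
    (hpq : (p : ℕ) + q + 1 = m) : sortedEig (-B) p = - sortedEig B q := by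
  obtain ⟨v, hv⟩ := se_spec B h
  obtain ⟨w, hw⟩ := se_spec (-B) h.neg
  apply le_antisymm
  · obtain ⟨x, hx0, hx⟩ := exists_ker (m := m)
      (κ := {s : Fin m // s < p} ⊕ {s : Fin m // s < q})
      (Sum.elim (fun s => w s.1) (fun s => v s.1)) (by
        simp only [Fintype.card_sum, Fintype.card_subtype, Finset.filter_gt_eq_Iio, Fin.card_Iio]
        omega)
    have h1 := low_bound _ (se_mono B) q (fun s => v s ⬝ᵥ x) (fun s hs => hx (Sum.inr ⟨s, hs⟩))
    have h2 := low_bound _ (se_mono (-B)) p (fun s => w s ⬝ᵥ x) (fun s hs => hx (Sum.inl ⟨s, hs⟩))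
    rw [← (hv x).1, ← (hv x).2] at h1
    rw [← (hw x).1, ← (hw x).2, neg_mulVec, dotProduct_neg] at h2
    have := dot_pos hx0
    refine le_of_mul_le_mul_right ?_ this
    linarith
  · obtain ⟨x, hx0, hx⟩ := exists_ker (m := m)
      (κ := {s : Fin m // p < s} ⊕ {s : Fin m // q < s})
      (Sum.elim (fun s => w s.1) (fun s => v s.1)) (by
        simp only [Fintype.card_sum, Fintype.card_subtype, Finset.filter_lt_eq_Ioi, Fin.card_Ioi]
        omega)
    have h1 := up_bound _ (se_mono B) q (fun s => v s ⬝ᵥ x) (fun s hs => hx (Sum.inr ⟨s, hs⟩))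
    have h2 := up_bound _ (se_mono (-B)) p (fun s => w s ⬝ᵥ x) (fun s hs => hx (Sum.inl ⟨s, hs⟩))
    rw [← (hv x).1, ← (hv x).2] at h1
    rw [← (hw x).1, ← (hw x).2, neg_mulVec, dotProduct_neg] at h2
    have := dot_pos hx0
    refine le_of_mul_le_mul_right ?_ this
    linarith

open Matrix in
theorem norm_bd {n : ℕ} (A : Matrix (Fin n) (Fin n) ℝ) (z : Fin n → ℝ) :
    (A *ᵥ z) ⬝ᵥ (A *ᵥ z) ≤ (∑ r, ∑ s, A r s ^ 2) * (z ⬝ᵥ z) := by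
  rw [Finset.sum_mul]
  refine Finset.sum_le_sum fun r _ => ?_
  have := Finset.sum_mul_sq_le_sq_mul_sq Finset.univ (fun s => A r s) z
  simp only [mulVec, dotProduct, ← pow_two]
  exact this

open Matrix in
theorem two_dot {n : ℕ} (y w : Fin n → ℝ) {δ : ℝ} (hδ : 0 < δ) :
    2 * (y ⬝ᵥ w) ≤ δ⁻¹ * (y ⬝ᵥ y) + δ * (w ⬝ᵥ w) := by
  simp only [dotProduct, Finset.mul_sum, ← Finset.sum_add_distrib]
  refine Finset.sum_le_sum fun r _ => ?_
  have h : 0 ≤ δ⁻¹ * (y r - δ * w r) ^ 2 := by positivity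
  have e : δ⁻¹ * (y r - δ * w r) ^ 2
      = δ⁻¹ * (y r * y r) + δ * (w r * w r) - 2 * (y r * w r) := by
    field_simp; ring
  linarith

open Matrix in
theorem herm_family {n : ℕ} (d : Fin n → ℝ) (A : Matrix (Fin n) (Fin n) ℝ) (hA : A.IsHermitian)
    (t : ℝ) : (Matrix.diagonal d + t • A).IsHermitian := by
  have hA' : Aᵀ = A := (by simpa using hA : A.IsSymm)
  rw [Matrix.IsHermitian, conjTranspose_eq_transpose_of_trivial, transpose_add, transpose_smul,
    diagonal_transpose, hA']

open Matrix in
theorem upper_lem {n q : ℕ} (d : Fin n → ℝ) (μ g : ℝ) (hg : 0 < g) (S : Finset (Fin n))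
    (hS : ∀ l ∈ S, d l ≤ μ - g) (e : Fin q → Fin n) (he : Function.Injective e)
    (hd : ∀ r, d (e r) = μ) (A : Matrix (Fin n) (Fin n) ℝ) (hA : A.IsHermitian)
    (r : Fin q) (p : Fin n) (hp : (p : ℕ) = S.card + r) (ε : ℝ) (hε : 0 < ε) :
    ∀ᶠ t in nhdsWithin (0 : ℝ) (Set.Ioi 0),
      (sortedEig (Matrix.diagonal d + t • A) p - μ) / t ≤ sortedEig (A.submatrix e e) r + ε := by
  set a := sortedEig (A.submatrix e e) r with ha
  set C := ∑ r, ∑ s, A r s ^ 2 with hC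
  have hC0 : 0 ≤ C := Finset.sum_nonneg fun _ _ => Finset.sum_nonneg fun _ _ => sq_nonneg _
  set δ := ε / (C + 1) with hδ
  have hδ0 : 0 < δ := by positivity
  have hδC : δ * C ≤ ε := by
    rw [hδ, div_mul_eq_mul_div, div_le_iff₀ (by positivity)]; nlinarith
  set K := δ⁻¹ + (1 + C) / 2 - a - ε with hK
  have hev : ∀ᶠ t in nhdsWithin (0 : ℝ) (Set.Ioi 0), t * K < g := by
    apply Filter.Eventually.filter_mono nhdsWithin_le_nhds
    have : Filter.Tendsto (fun t : ℝ => t * K) (nhds 0) (nhds (0 * K)) :=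
      (continuous_id.mul continuous_const).tendsto 0
    rw [zero_mul] at this
    exact this.eventually_lt_const hg
  filter_upwards [hev, self_mem_nhdsWithin] with t ht ht0
  have ht0 : 0 < t := ht0
  set B := Matrix.diagonal d + t • A with hB
  have hBH : B.IsHermitian := herm_family d A hA t
  have hEH : (A.submatrix e e).IsHermitian := hA.submatrix e
  obtain ⟨v, hv⟩ := se_spec B hBH
  obtain ⟨u, hu⟩ := se_spec _ hEH
  have heS : ∀ s, e s ∉ S := fun s hs => by have := hS _ hs; rw [hd] at this; linarith
  set R := S ∪ Finset.univ.image e with hR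
  have hRc : R.card = S.card + q := by
    rw [hR, Finset.card_union_of_disjoint, Finset.card_image_of_injective _ he]
    · simp
    · rw [Finset.disjoint_right]
      intro l hl
      obtain ⟨s, -, rfl⟩ := Finset.mem_image.1 hl
      exact heS s
  have hRn : R.card ≤ n := by simpa using Finset.card_le_univ R
  -- extension of a vector on the block
  have hext : ∀ (f : Fin n → ℝ), (∀ l, l ∉ Set.range e → f l = 0) →
      ∑ s, f (e s) = ∑ l, f l := fun f hf =>
    Fintype.sum_of_injective e he _ _ (fun l hl => hf l hl) (fun _ => rfl)
  obtain ⟨x, hx0, hx⟩ := exists_ker (m := n)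
    (κ := {l : Fin n // l ∈ Rᶜ} ⊕ ({s : Fin q // r < s} ⊕ {s : Fin n // s < p}))
    (Sum.elim (fun l => Pi.single l.1 1) (Sum.elim
      (fun s l => ∑ b, if e b = l then u s.1 b else 0) (fun s => v s.1))) (by
      rw [Fintype.card_sum, Fintype.card_coe, Finset.card_compl]
      simp only [Fintype.card_sum, Fintype.card_subtype,
        Finset.filter_lt_eq_Ioi, Finset.filter_gt_eq_Iio, Fin.card_Ioi, Fin.card_Iio,
        Fintype.card_fin]
      have := r.2
      omega)
  have hxR : ∀ l, l ∉ R → x l = 0 := fun l hl => by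
    have := hx (Sum.inl ⟨l, Finset.mem_compl.2 hl⟩)
    simpa using this
  have hxu : ∀ s, r < s → u s ⬝ᵥ (x ∘ e) = 0 := fun s hs => by
    have := hx (Sum.inr (Sum.inl ⟨s, hs⟩))
    simp only [Sum.elim_inr, Sum.elim_inl, dotProduct, Finset.sum_mul] at this
    rw [Finset.sum_comm] at this
    simpa [dotProduct] using this
  have h1 := low_bound _ (se_mono B) p (fun s => v s ⬝ᵥ x)
    (fun s hs => hx (Sum.inr (Sum.inr ⟨s, hs⟩)))
  have h2 := up_bound _ (se_mono (A.submatrix e e)) r (fun s => u s ⬝ᵥ (x ∘ e)) hxu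
  rw [← (hv x).1, ← (hv x).2] at h1
  rw [← (hu _).1, ← (hu _).2, ← ha] at h2
  set y : Fin n → ℝ := fun l => if l ∈ S then x l else 0 with hy
  set z : Fin n → ℝ := fun l => if l ∈ S then 0 else x l with hz
  have hxyz : x = y + z := by ext l; simp only [hy, hz, Pi.add_apply]; split_ifs <;> simp
  have hze : z ∘ e = x ∘ e := by ext s; simp [hz, heS]
  have hz0 : ∀ l, l ∉ Set.range e → z l = 0 := fun l hl => by
    simp only [hz]; split_ifs with h
    · rfl
    · apply hxR; simp only [hR, Finset.mem_union, Finset.mem_image, Finset.mem_univ, true_and]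
      rintro (h' | h')
      · exact h h'
      · exact hl h'
  have e1 : (x ∘ e) ⬝ᵥ (x ∘ e) = z ⬝ᵥ z := by
    rw [← hze]
    exact hext (fun l => z l * z l) fun l hl => by simp [hz0 l hl]
  have e2 : (x ∘ e) ⬝ᵥ (A.submatrix e e *ᵥ (x ∘ e)) = z ⬝ᵥ (A *ᵥ z) := by
    rw [← hze]
    have : A.submatrix e e *ᵥ (z ∘ e) = (A *ᵥ z) ∘ e := by
      ext b
      exact hext (fun l => A (e b) l * z l) fun l hl => by simp [hz0 l hl]
    rw [this]
    exact hext (fun l => z l * (A *ᵥ z) l) fun l hl => by simp [hz0 l hl]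
  have e3 : x ⬝ᵥ x = y ⬝ᵥ y + z ⬝ᵥ z := by
    simp only [dotProduct, ← Finset.sum_add_distrib]
    refine Finset.sum_congr rfl fun l _ => ?_
    simp only [hy, hz]; split_ifs <;> simp
  have e4 : x ⬝ᵥ (Matrix.diagonal d *ᵥ x) ≤ (μ - g) * (y ⬝ᵥ y) + μ * (z ⬝ᵥ z) := by
    simp only [dotProduct, mulVec_diagonal, Finset.mul_sum, ← Finset.sum_add_distrib]
    refine Finset.sum_le_sum fun l _ => ?_
    by_cases h : l ∈ S
    · simp only [hy, hz, h, if_true]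
      nlinarith [hS l h, mul_self_nonneg (x l)]
    · by_cases h' : l ∈ Set.range e
      · obtain ⟨s, rfl⟩ := h'
        simp only [hy, hz, h, if_false, hd]
        nlinarith
      · have := hz0 l h'
        simp only [hz, h, if_false] at this
        simp [hy, hz, h, this]
  have e5 : x ⬝ᵥ (A *ᵥ x) = y ⬝ᵥ (A *ᵥ y) + 2 * (y ⬝ᵥ (A *ᵥ z)) + z ⬝ᵥ (A *ᵥ z) := by
    have hA' : Aᵀ = A := (by simpa using hA : A.IsSymm)
    have : z ⬝ᵥ (A *ᵥ y) = y ⬝ᵥ (A *ᵥ z) := by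
      rw [dotProduct_mulVec, ← mulVec_transpose, hA', dotProduct_comm]
    rw [hxyz, mulVec_add, add_dotProduct, dotProduct_add, dotProduct_add, this]; ring
  have e6 : x ⬝ᵥ (B *ᵥ x) = x ⬝ᵥ (Matrix.diagonal d *ᵥ x) + t * (x ⬝ᵥ (A *ᵥ x)) := by
    rw [hB, add_mulVec, dotProduct_add, smul_mulVec, dotProduct_smul, smul_eq_mul]
  have b1 := two_dot y (A *ᵥ y) one_pos
  have b2 := norm_bd A y
  have b3 := two_dot y (A *ᵥ z) hδ0
  have b4 := norm_bd A z
  have hyy : 0 ≤ y ⬝ᵥ y := Finset.sum_nonneg fun i _ => mul_self_nonneg _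
  have hzz : 0 ≤ z ⬝ᵥ z := Finset.sum_nonneg fun i _ => mul_self_nonneg _
  have b5 : δ * ((A *ᵥ z) ⬝ᵥ (A *ᵥ z)) ≤ ε * (z ⬝ᵥ z) :=
    calc _ ≤ δ * (C * (z ⬝ᵥ z)) := by gcongr
      _ = (δ * C) * (z ⬝ᵥ z) := by ring
      _ ≤ _ := by gcongr
  rw [e1, e2] at h2
  have b6 : x ⬝ᵥ (A *ᵥ x) ≤ (a + ε) * (x ⬝ᵥ x) + K * (y ⬝ᵥ y) := by
    rw [e5, e3, hK]
    rw [← hC] at b2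
    norm_num at b1
    nlinarith
  have b7 : x ⬝ᵥ (B *ᵥ x) ≤ (μ + t * (a + ε)) * (x ⬝ᵥ x) := by
    have := mul_le_mul_of_nonneg_left b6 ht0.le
    have h3 := mul_le_mul_of_nonneg_right ht.le hyy
    rw [e6]
    have : μ * (x ⬝ᵥ x) = μ * (y ⬝ᵥ y) + μ * (z ⬝ᵥ z) := by rw [e3]; ring
    nlinarith
  have := le_of_mul_le_mul_right (h1.trans b7) (dot_pos hx0)
  rw [div_le_iff₀ ht0]
  linarith

theorem gap_exists {n : ℕ} (d : Fin n → ℝ) (μ : ℝ) (S : Finset (Fin n))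
    (hS : ∀ l ∈ S, d l < μ) : ∃ g : ℝ, 0 < g ∧ ∀ l ∈ S, d l ≤ μ - g := by
  induction S using Finset.induction_on with
  | empty => exact ⟨1, one_pos, by simp⟩
  | insert b S hb ih =>
    obtain ⟨g, hg, h⟩ := ih fun l hl => hS l (Finset.mem_insert_of_mem hl)
    have hb' := hS b (Finset.mem_insert_self _ _)
    refine ⟨min g (μ - d b), lt_min hg (by linarith), fun l hl => ?_⟩
    rcases Finset.mem_insert.1 hl with rfl | hl
    · have := min_le_right g (μ - d l); linarith
    · have := min_le_left g (μ - d b); have := h l hl; linarith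

theorem onesided {n q : ℕ} (d : Fin n → ℝ) (μ : ℝ) (S T : Finset (Fin n))
    (hS : ∀ l ∈ S, d l < μ) (hT : ∀ l ∈ T, μ < d l)
    (e : Fin q → Fin n) (he : Function.Injective e)
    (hd : ∀ r, d (e r) = μ) (hcard : S.card + q + T.card = n)
    (A : Matrix (Fin n) (Fin n) ℝ) (hA : A.IsHermitian)
    (r : Fin q) (p : Fin n) (hp : (p : ℕ) = S.card + r) :
    Filter.Tendsto (fun t : ℝ => (sortedEig (Matrix.diagonal d + t • A) p - μ) / t)
      (nhdsWithin 0 (Set.Ioi 0)) (nhds (sortedEig (A.submatrix e e) r)) := by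
  obtain ⟨g, hg, hg'⟩ := gap_exists d μ S hS
  obtain ⟨g2, hg2, hg2'⟩ := gap_exists (fun l => - d l) (-μ) T (fun l hl => neg_lt_neg (hT l hl))
  have hr := r.2
  have hpn := p.2
  let r' : Fin q := ⟨q - 1 - r, by omega⟩
  let p' : Fin n := ⟨n - 1 - p, by omega⟩
  rw [Metric.tendsto_nhds]
  intro ε hε
  have h1 := upper_lem d μ g hg S hg' e he hd A hA r p hp (ε / 2) (by positivity)
  have h2 := upper_lem (fun l => - d l) (-μ) g2 hg2 T hg2' e he (fun r => by simp [hd]) (-A) hA.neg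
    r' p' (by simp only [r', p']; omega) (ε / 2) (by positivity)
  filter_upwards [h1, h2, self_mem_nhdsWithin] with t h1 h2 ht
  have ht : 0 < t := ht
  have e1 : Matrix.diagonal (fun l => - d l) + t • (-A) = -(Matrix.diagonal d + t • A) := by
    rw [neg_add, smul_neg, Matrix.diagonal_neg]
  rw [e1, se_neg _ (herm_family d A hA t) p' p (by simp only [p']; omega), Matrix.submatrix_neg,
    Pi.neg_apply, Pi.neg_apply,
    se_neg _ (hA.submatrix e) r' r (by simp only [r']; omega)] at h2
  rw [Real.dist_eq, abs_lt]
  have e2 : (-sortedEig (Matrix.diagonal d + t • A) p - -μ) / t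
    = - ((sortedEig (Matrix.diagonal d + t • A) p - μ) / t) := by ring
  rw [e2] at h2
  constructor <;> linarith

theorem twosided {n q : ℕ} (d : Fin n → ℝ) (μ : ℝ) (S T : Finset (Fin n))
    (hS : ∀ l ∈ S, d l < μ) (hT : ∀ l ∈ T, μ < d l)
    (e : Fin q → Fin n) (he : Function.Injective e)
    (hd : ∀ r, d (e r) = μ) (hcard : S.card + q + T.card = n)
    (A : Matrix (Fin n) (Fin n) ℝ) (hA : A.IsHermitian)
    (r r' : Fin q) (hr : (r : ℕ) + r' + 1 = q) (p : Fin n) (hp : (p : ℕ) = S.card + r) :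
    (∃ c, Filter.Tendsto (fun t : ℝ => (sortedEig (Matrix.diagonal d + t • A) p - μ) / t)
      (nhdsWithin 0 {0}ᶜ) (nhds c)) ↔
      sortedEig (A.submatrix e e) r = sortedEig (A.submatrix e e) r' := by
  have h1 := onesided d μ S T hS hT e he hd hcard A hA r p hp
  have h2 := onesided d μ S T hS hT e he hd hcard (-A) hA.neg r p hp
  rw [Matrix.submatrix_neg, Pi.neg_apply, Pi.neg_apply, se_neg _ (hA.submatrix e) r r' hr] at h2
  have hneg : Filter.Tendsto (fun t : ℝ => -t) (nhdsWithin 0 (Set.Iio 0))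
      (nhdsWithin 0 (Set.Ioi 0)) := by
    have := tendsto_neg_nhdsLT (a := (0 : ℝ))
    simpa using this
  have h3 := (h2.comp hneg).neg
  rw [neg_neg] at h3
  have h4 : Filter.Tendsto (fun t : ℝ => (sortedEig (Matrix.diagonal d + t • A) p - μ) / t)
      (nhdsWithin 0 (Set.Iio 0)) (nhds (sortedEig (A.submatrix e e) r')) := by
    refine h3.congr fun t => ?_
    simp only [Function.comp, smul_neg, neg_smul, neg_neg, div_neg]
  rw [← Set.Iio_union_Ioi, nhdsWithin_union]
  constructor
  · rintro ⟨c, hc⟩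
    rw [tendsto_nhds_unique h1 (hc.mono_left le_sup_right),
      tendsto_nhds_unique h4 (hc.mono_left le_sup_left)]
  · intro h
    exact ⟨_, h4.sup (h ▸ h1)⟩

theorem scalar_iff {q : ℕ} (B : Matrix (Fin q) (Fin q) ℝ) (hB : B.IsHermitian) (r r' : Fin q)
    (hr : (r : ℕ) = 0) (hr' : (r' : ℕ) + 1 = q) :
    sortedEig B r = sortedEig B r' ↔ ∃ c : ℝ, B = c • (1 : Matrix (Fin q) (Fin q) ℝ) := by
  have hs : ∀ s, sortedEig B s = hB.eigenvalues (Tuple.sort hB.eigenvalues s) := by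
    intro s; rw [sortedEig, dif_pos hB]; rfl
  constructor
  · intro h
    refine ⟨sortedEig B r, ?_⟩
    have hc : ∀ s, sortedEig B s = sortedEig B r := fun s => le_antisymm
      (h ▸ se_mono B (Fin.le_def.2 (by omega))) (se_mono B (Fin.le_def.2 (by omega)))
    have he : hB.eigenvalues = fun _ => sortedEig B r := by
      ext s
      rw [← hc ((Tuple.sort hB.eigenvalues).symm s), hs]
      simp
    generalize sortedEig B r = c at he
    have := hB.spectral_theorem
    rw [he] at this
    rw [this]
    have e : (Matrix.diagonal ((RCLike.ofReal : ℝ → ℝ) ∘ fun _ : Fin q => c))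
      = c • (1 : Matrix (Fin q) (Fin q) ℝ) := by
      rw [Matrix.smul_one_eq_diagonal]; rfl
    rw [e, map_smul, map_one]
  · rintro ⟨c, hc⟩
    have he : ∀ s, hB.eigenvalues s = c := by
      intro s
      have h1 := hB.mulVec_eigenvectorBasis s
      have h0 : (hB.eigenvectorBasis s) ≠ 0 := hB.eigenvectorBasis.orthonormal.ne_zero s
      generalize hB.eigenvalues s = x at *
      generalize hB.eigenvectorBasis s = v at *
      rw [hc, Matrix.smul_mulVec, Matrix.one_mulVec] at h1
      by_contra hne
      apply h0
      ext l
      have := congrFun h1 l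
      simp only [Pi.smul_apply, smul_eq_mul] at this
      have h5 : (c - x) * v.ofLp l = 0 := by linarith
      rcases mul_eq_zero.1 h5 with h | h
      · exact absurd (by linarith) hne
      · simpa using h
    rw [hs, hs, he, he]

/-- Two-sided differentiability of sorted eigenvalues: with `M = diagonal lam`,
`lam_{j-1} < lam_j = ⋯ = lam_k < lam_{k+1}`, `j ≤ i ≤ k` and `A` symmetric, the derivative
`d/dt|₀ λ_i(M + tA)` exists iff `λ_{i−j+1}(A|_E) = λ_{k−i+1}(A|_E)`; in particular `λ_j` is
differentiable in direction `A` iff `A|_E` is a scalar matrix. -/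
theorem twosided_eigenvalue_derivative {n : ℕ} (lam : Fin n → ℝ) (hmono : Monotone lam)
    (j k i : ℕ) (hjk : j ≤ k) (hk : k < n) (hji : j ≤ i) (hik : i ≤ k)
    (hlow : ∀ l : Fin n, (l : ℕ) < j → lam l < lam ⟨j, by omega⟩)
    (hhigh : ∀ l : Fin n, k < (l : ℕ) → lam ⟨k, by omega⟩ < lam l)
    (heq : ∀ l : Fin n, j ≤ (l : ℕ) → (l : ℕ) ≤ k → lam l = lam ⟨j, by omega⟩)
    (A : Matrix (Fin n) (Fin n) ℝ) (hA : A.IsSymm) :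
    ((∃ d : ℝ, Filter.Tendsto
        (fun t : ℝ =>
          (sortedEig (Matrix.diagonal lam + t • A) ⟨i, by omega⟩ - lam ⟨i, by omega⟩) / t)
        (nhdsWithin 0 {0}ᶜ) (nhds d)) ↔
      sortedEig
        (A.submatrix (fun r : Fin (k + 1 - j) => (⟨j + r, by have := r.isLt; omega⟩ : Fin n))
          (fun r : Fin (k + 1 - j) => (⟨j + r, by have := r.isLt; omega⟩ : Fin n)))
        ⟨i - j, by omega⟩
      = sortedEig
        (A.submatrix (fun r : Fin (k + 1 - j) => (⟨j + r, by have := r.isLt; omega⟩ : Fin n))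
          (fun r : Fin (k + 1 - j) => (⟨j + r, by have := r.isLt; omega⟩ : Fin n)))
        ⟨k - i, by omega⟩) ∧
    ((∃ d : ℝ, Filter.Tendsto
        (fun t : ℝ =>
          (sortedEig (Matrix.diagonal lam + t • A) ⟨j, by omega⟩ - lam ⟨j, by omega⟩) / t)
        (nhdsWithin 0 {0}ᶜ) (nhds d)) ↔
      ∃ c : ℝ,
        A.submatrix (fun r : Fin (k + 1 - j) => (⟨j + r, by have := r.isLt; omega⟩ : Fin n))
          (fun r : Fin (k + 1 - j) => (⟨j + r, by have := r.isLt; omega⟩ : Fin n))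
        = c • (1 : Matrix (Fin (k + 1 - j)) (Fin (k + 1 - j)) ℝ)) := by
  have hAH : A.IsHermitian := by simpa using hA
  let e : Fin (k + 1 - j) → Fin n := fun r => ⟨j + r, by have := r.isLt; omega⟩
  have he : Function.Injective e := fun a b h => by
    have := congrArg Fin.val h
    simp only [e] at this
    exact Fin.ext (by omega)
  have hjn : j < n := by omega
  let S : Finset (Fin n) := Finset.Iio ⟨j, by omega⟩
  let T : Finset (Fin n) := Finset.Ioi ⟨k, by omega⟩
  have hSc : S.card = j := by simp [S]
  have hTc : T.card = n - 1 - k := by simp [T]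
  have hmain := fun (i : ℕ) (hji : j ≤ i) (hik : i ≤ k) =>
    twosided lam (lam ⟨j, by omega⟩) S T
    (fun l hl => hlow l (Fin.lt_def.1 (Finset.mem_Iio.1 hl)))
    (fun l hl => by
      rw [← heq ⟨k, by omega⟩ hjk le_rfl]
      exact hhigh l (Fin.lt_def.1 (Finset.mem_Ioi.1 hl)))
    e he (fun r => heq _ (by simp [e]) (by have := r.2; simp only [e]; omega)) (by omega)
    A hAH ⟨i - j, by omega⟩ ⟨k - i, by omega⟩ (by simp only; omega) ⟨i, by omega⟩
    (by simp only [hSc]; omega)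
  refine ⟨?_, ?_⟩
  · rw [heq ⟨i, by omega⟩ hji hik]
    exact hmain i hji hik
  · rw [hmain j le_rfl hjk]
    exact scalar_iff (A.submatrix e e) (hAH.submatrix e) _ _ (by simp) (by simp only; omega)
end
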